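/- Let G = (V, E, w) be a finite directed graph with integer edge weights. If G contains no negative cycle (every directed simple cycle has nonnegative total weight), then there exists a valid potential function φ : V → ℤ, i.e., a function satisfying w(u, v) + φ(u) − φ(v) ≥ 0 for every edge (u, v) ∈ E. -/

import Mathlib

/-- `p` is a walk from `u` to `v` in the directed graph with edge relation `E`:
a nonempty sequence of vertices starting at `u`, ending at `v`, with consecutive
vertices joined by edges. -/
def IsWalkFrom {V : Type*} (E : V → V → Prop) (p : List V) (u v : V) : Prop :=
  p.Chain' E ∧ p.head? = some u ∧ p.getLast? = some v

/-- The total weight of a walk: the sum of `w` over consecutive pairs of vertices. -/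
def walkWeight {V : Type*} (w : V → V → ℤ) (p : List V) : ℤ :=
  ((p.zip p.tail).map fun e => w e.1 e.2).sum

/-- `c` is a directed simple cycle: a nonempty list of pairwise distinct vertices
`v₀, …, v_{k-1}` such that the closed walk `v₀, …, v_{k-1}, v₀` uses only edges.
The cycle has `c.length` edges. -/
def IsCycle {V : Type*} (E : V → V → Prop) (c : List V) : Prop :=
  c ≠ [] ∧ c.Nodup ∧ (c ++ c.take 1).Chain' E

/-- The total weight of a directed simple cycle. -/
def cycleWeight {V : Type*} (w : V → V → ℤ) (c : List V) : ℤ :=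
  walkWeight w (c ++ c.take 1)

theorem walkWeight_cons_cons {V : Type*} (w : V → V → ℤ) (a b : V) (l : List V) :
    walkWeight w (a :: b :: l) = w a b + walkWeight w (b :: l) := by
  simp [walkWeight]

theorem walkWeight_append_cons {V : Type*} (w : V → V → ℤ) (l₁ : List V) (c : V) (l₂ : List V) :
    walkWeight w (l₁ ++ c :: l₂) = walkWeight w (l₁ ++ [c]) + walkWeight w (c :: l₂) := by
  induction l₁ with
  | nil => simp [walkWeight]
  | cons a l ih =>
    cases l with
    | nil => simp [walkWeight]
    | cons b l =>
      simp only [List.cons_append, walkWeight_cons_cons] at ih ⊢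
      rw [ih, add_assoc]

/-- In a finite graph, some simple walk starting at `v` has least weight among all of them. -/
theorem exists_min_weight_simple_walk {V : Type*} [Finite V] (E : V → V → Prop) (w : V → V → ℤ)
    (v : V) :
    ∃ p : List V, ((v :: p).Nodup ∧ (v :: p).IsChain E) ∧
      ∀ q : List V, (v :: q).Nodup ∧ (v :: q).IsChain E →
        walkWeight w (v :: p) ≤ walkWeight w (v :: q) := by
  have := Fintype.ofFinite V
  have hfin : {p : List V | (v :: p).Nodup ∧ (v :: p).IsChain E}.Finite :=
    (List.finite_length_le V (Fintype.card V)).subset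
      fun p hp => (List.nodup_cons.1 hp.1).2.length_le_card
  exact Set.exists_min_image _ (fun p => walkWeight w (v :: p)) hfin
    ⟨[], List.nodup_singleton v, List.isChain_singleton v⟩

/-- Without negative cycles, a walk obtained by prepending an edge to a simple walk is at least as
heavy as some simple walk with the same initial vertex. -/
theorem exists_simple_walk_weight_le {V : Type*} {E : V → V → Prop} {w : V → V → ℤ}
    (hcyc : ∀ c : List V, IsCycle E c → 0 ≤ cycleWeight w c) {u : V} {p : List V}
    (hp : p.Nodup) (hup : (u :: p).IsChain E) :
    ∃ q : List V, ((u :: q).Nodup ∧ (u :: q).IsChain E) ∧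
      walkWeight w (u :: q) ≤ walkWeight w (u :: p) := by
  by_cases hu : u ∈ p
  · obtain ⟨a, b, rfl⟩ := List.append_of_mem hu
    have hsplit := List.isChain_split.1 (show ((u :: a) ++ u :: b).IsChain E from hup)
    have hcycle : IsCycle E (u :: a) := by
      refine ⟨by simp, ?_, hsplit.1⟩
      have := List.nodup_middle.1 hp
      exact this.sublist (by simp)
    have hc : 0 ≤ walkWeight w (u :: a ++ [u]) := by
      simpa [cycleWeight] using hcyc _ hcycle
    refine ⟨b, ⟨hp.sublist (List.sublist_append_right _ _), hsplit.2⟩, ?_⟩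
    have := walkWeight_append_cons w (u :: a) u b
    rw [List.cons_append] at this
    linarith
  · exact ⟨p, ⟨List.nodup_cons.2 ⟨hu, hp⟩, hup⟩, le_rfl⟩

/-- if a finite directed graph contains no negative cycle (every
directed simple cycle has nonnegative total weight), then there exists a valid
potential function `φ`, i.e. `w(u,v) + φ(u) - φ(v) ≥ 0` for every edge `(u,v)`. -/
theorem no_negCycle_exists_validPotential {V : Type*} [Fintype V]
    (E : V → V → Prop) (w : V → V → ℤ)
    (hcyc : ∀ c : List V, IsCycle E c → 0 ≤ cycleWeight w c) :
    ∃ φ : V → ℤ, ∀ u v : V, E u v → 0 ≤ w u v + φ u - φ v := by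
  choose p hp hmin using exists_min_weight_simple_walk E w
  refine ⟨fun v => -walkWeight w (v :: p v), fun u v huv => ?_⟩
  obtain ⟨q, hq, hle⟩ := exists_simple_walk_weight_le hcyc (hp v).1
    (List.isChain_cons_cons.2 ⟨huv, (hp v).2⟩)
  have := hmin u q hq
  rw [walkWeight_cons_cons] at hle
  linarith
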